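/- Let R = (C, Δ) be a generalized root system for a connected basic datum (X, ρ), and let w = ς_{i_1}^x ς_{i_2} ⋯ ς_{i_t} be a reduced expression in the Weyl groupoid, i.e. ℓ(w) = t. Write w = (x, g, y) with g = s_{i_1}^x s_{i_2} ⋯ s_{i_t} ∈ GL(ℤ^I) and y = ρ_{i_t} ⋯ ρ_{i_1}(x). Then for every j ∈ I: ℓ(w ς_j^y) = t + 1 if and only if g(α_j) ∈ Δ^x_+, i.e. if and only if g(α_j) ∈ ℕ_0^I. -/

import Mathlib

open Function

/-- The reflection `s_i` determined by the `i`-th row of a generalized Cartan matrix `C`,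
acting on `ℤ^θ`; on the standard basis it is `s_i(α_j) = α_j - C i j • α_i`. -/
def cartanRefl {θ : ℕ} (C : Matrix (Fin θ) (Fin θ) ℤ) (i : Fin θ) :
    (Fin θ → ℤ) → (Fin θ → ℤ) :=
  fun v => v - (∑ j, C i j * v j) • Pi.single i 1

/-- A generalized root system `(C, Δ)` over a connected basic datum `(X, ρ)`. -/
structure GRS (θ : ℕ) (X : Type*) where
  nonempty : Nonempty X
  /-- The basic datum: a family of involutive permutations of `X`. -/
  ρ : Fin θ → Equiv.Perm X
  ρ_invol : ∀ i, ρ i * ρ i = 1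
  /-- Connectedness of the basic datum. -/
  connected : ∀ x y : X, Relation.ReflTransGen (fun a b => ∃ i, ρ i a = b) x y
  /-- The Cartan datum: a bundle of generalized Cartan matrices. -/
  C : X → Matrix (Fin θ) (Fin θ) ℤ
  C_diag : ∀ x i, C x i i = 2
  C_offdiag : ∀ x i j, i ≠ j → C x i j ≤ 0
  C_zero_iff : ∀ x i j, i ≠ j → (C x i j = 0 ↔ C x j i = 0)
  C_compat : ∀ x i j, C (ρ i x) i j = C x i j
  /-- The bundle of root sets. -/
  Δ : X → Set (Fin θ → ℤ)
  /-- Axiom (1): `Δ^x = Δ^x_+ ∪ Δ^x_-`, where `Δ^x_± = ±(Δ^x ∩ ℕ₀^θ)`. -/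
  root_pos_neg : ∀ x, Δ x = (Δ x ∩ {v | ∀ k, 0 ≤ v k}) ∪ ((fun v => -v) '' (Δ x ∩ {v | ∀ k, 0 ≤ v k}))
  /-- Axiom (2): `Δ^x ∩ ℤα_i = {α_i, -α_i}`. -/
  root_simple : ∀ x i, Δ x ∩ {v | ∃ n : ℤ, v = n • (Pi.single i 1 : Fin θ → ℤ)}
      = {Pi.single i 1, -Pi.single i 1}
  /-- Axiom (3): `s_i^x(Δ^x) = Δ^{ρ_i(x)}`. -/
  root_refl : ∀ x i, cartanRefl (C x) i '' Δ x = Δ (ρ i x)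
  /-- Axiom (4): `(ρ_i ρ_j)^{m^x_{ij}}(x) = x` where `m^x_{ij} = |Δ^x ∩ (ℕ₀α_i + ℕ₀α_j)|`. -/
  root_coxeter : ∀ x i j, i ≠ j →
    (Δ x ∩ {v | ∃ p q : ℕ, v = p • (Pi.single i 1 : Fin θ → ℤ) + q • Pi.single j 1}).Finite →
    ((ρ i * ρ j) ^
      (Δ x ∩ {v | ∃ p q : ℕ, v = p • (Pi.single i 1 : Fin θ → ℤ) + q • Pi.single j 1}).ncard) x = x

namespace GRS

variable {θ : ℕ} {X : Type*} (R : GRS θ X)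

/-- The set of positive roots `Δ^x_+` at `x`. -/
def pos (x : X) : Set (Fin θ → ℤ) := {v ∈ R.Δ x | ∀ k, 0 ≤ v k}

/-- Membership in the Weyl groupoid `W(R)`: `Weyl R x g y` says that the triple `(x, g, y)`
belongs to the subgroupoid of `X × GL(ℤ^θ) × X` generated by the `ς_i^x = (x, s_i^x, ρ_i(x))`. -/
inductive Weyl : X → ((Fin θ → ℤ) → (Fin θ → ℤ)) → X → Prop
  | nil (x : X) : Weyl x _root_.id x
  | cons (x : X) (i : Fin θ) {g : (Fin θ → ℤ) → (Fin θ → ℤ)} {y : X} :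
      Weyl (R.ρ i x) g y → Weyl x (cartanRefl (R.C x) i ∘ g) y

/-- Endpoint of the word `ς_{i_1}^x ς_{i_2} ⋯ ς_{i_t}` (with implicit superscripts). -/
def wordEnd : X → List (Fin θ) → X
  | x, [] => x
  | x, i :: l => wordEnd (R.ρ i x) l

/-- The element of `GL(ℤ^θ)` given by the word `ς_{i_1}^x ς_{i_2} ⋯ ς_{i_t}`:
the composition `s_{i_1}^x ∘ s_{i_2}^{ρ_{i_1}(x)} ∘ ⋯`. -/
def wordMap : X → List (Fin θ) → ((Fin θ → ℤ) → (Fin θ → ℤ))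
  | _, [] => _root_.id
  | x, i :: l => cartanRefl (R.C x) i ∘ wordMap (R.ρ i x) l

/-- The length `ℓ(w)` of the element `w = (x, g, y)` of the Weyl groupoid: the least number of
generators needed to express it. -/
noncomputable def len (x : X) (g : (Fin θ → ℤ) → (Fin θ → ℤ)) (y : X) : ℕ :=
  sInf {t | ∃ l : List (Fin θ), l.length = t ∧ R.wordEnd x l = y ∧ R.wordMap x l = g}

/-- The set of real roots `(Δ^{re})^x` at `x`. -/
def realRoots (x : X) : Set (Fin θ → ℤ) :=
  {v | ∃ (i : Fin θ) (g : (Fin θ → ℤ) → (Fin θ → ℤ)) (y : X), R.Weyl x g y ∧ v = g (Pi.single i 1)}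

/-- The generalized root system is finite: its Weyl groupoid is a finite set. -/
def FiniteWeyl : Prop :=
  {p : X × ((Fin θ → ℤ) → (Fin θ → ℤ)) × X | R.Weyl p.1 p.2.1 p.2.2}.Finite

end GRS

namespace GRS

section Alternating

variable {α : Type*}

/-- The alternating word `p, q, p, …` of length `k`. -/
def alt : α → α → ℕ → List α
  | _, _, 0 => []
  | p, q, k + 1 => p :: alt q p k

/-- The letter continuing the alternating word `alt p q k`. -/
def nxt : α → α → ℕ → α
  | p, _, 0 => p
  | p, q, k + 1 => nxt q p k

theorem alt_length (p q : α) (k : ℕ) : (alt p q k).length = k := by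
  induction k generalizing p q with
  | zero => rfl
  | succ k ih => simp [alt, ih]

theorem alt_add (p q : α) (m k : ℕ) :
    alt p q (m + k) = alt p q m ++ alt (nxt p q m) (nxt q p m) k := by
  induction m generalizing p q with
  | zero => simp [alt, nxt]
  | succ m ih =>
    rw [Nat.add_right_comm]
    simp only [alt, nxt, List.cons_append]
    rw [ih]

theorem alt_succ' (p q : α) (k : ℕ) : alt p q (k + 1) = alt p q k ++ [nxt p q k] := by
  rw [alt_add]; simp [alt]

theorem nxt_cases (p q : α) (k : ℕ) :
    (nxt p q k = p ∧ nxt q p k = q) ∨ (nxt p q k = q ∧ nxt q p k = p) := by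
  induction k generalizing p q with
  | zero => simp [nxt]
  | succ k ih => have := ih p q; simp only [nxt]; tauto

theorem alt_two_mul (p q : α) (m : ℕ) :
    alt q p (2 * m) = alt q p m ++ (alt p q m).reverse := by
  induction m generalizing p q with
  | zero => simp [alt]
  | succ m ih =>
    have h : ∀ (a b : α) (m : ℕ), nxt a b (2 * m) = a := by
      intro a b m
      induction m with
      | zero => rfl
      | succ m ih => rw [Nat.mul_succ]; exact ih
    rw [show 2 * (m + 1) = (2 * m + 1) + 1 by ring, alt]
    rw [alt_succ', ih, h]
    simp [alt]

end Alternating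

variable {θ : ℕ} {X : Type*} (R : GRS θ X)

/-- The reflection `cartanRefl C i` as a linear map. -/
def reflLin (C : Matrix (Fin θ) (Fin θ) ℤ) (i : Fin θ) :
    (Fin θ → ℤ) →ₗ[ℤ] (Fin θ → ℤ) where
  toFun := cartanRefl C i
  map_add' v w := by
    simp only [cartanRefl, Pi.add_apply, mul_add, Finset.sum_add_distrib, add_smul]
    abel
  map_smul' a v := by
    simp only [cartanRefl, Pi.smul_apply, smul_eq_mul, RingHom.id_apply, smul_sub, smul_smul,
      Finset.mul_sum]
    congr 3
    funext k
    ring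

/-- The map `wordMap` as a linear map. -/
def wordLin : X → List (Fin θ) → ((Fin θ → ℤ) →ₗ[ℤ] (Fin θ → ℤ))
  | _, [] => LinearMap.id
  | x, i :: l => reflLin (R.C x) i ∘ₗ wordLin (R.ρ i x) l

theorem coe_wordLin (x : X) (l : List (Fin θ)) : ⇑(R.wordLin x l) = R.wordMap x l := by
  induction l generalizing x with
  | nil => rfl
  | cons i l ih => rw [wordMap, ← ih]; rfl

theorem ρ_ρ (i : Fin θ) (x : X) : R.ρ i (R.ρ i x) = x := by
  rw [← Equiv.Perm.mul_apply, R.ρ_invol]; rfl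

theorem cartanRefl_apply_ne (C : Matrix (Fin θ) (Fin θ) ℤ) {i c : Fin θ} (h : c ≠ i)
    (v : Fin θ → ℤ) : cartanRefl C i v c = v c := by
  simp [cartanRefl, h]

theorem cartanRefl_single (x : X) (i : Fin θ) :
    cartanRefl (R.C x) i (Pi.single i 1) = -Pi.single i 1 := by
  have : ∑ j, R.C x i j * (Pi.single i 1 : Fin θ → ℤ) j = 2 := by
    simp [Pi.single_apply, R.C_diag]
  rw [cartanRefl, this, two_smul]; abel

theorem cartanRefl_cartanRefl (x : X) (i : Fin θ) (v : Fin θ → ℤ) :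
    cartanRefl (R.C x) i (cartanRefl (R.C x) i v) = v := by
  have h1 : reflLin (R.C x) i (Pi.single i 1) = -Pi.single i 1 := R.cartanRefl_single x i
  change reflLin (R.C x) i (v - (∑ j, R.C x i j * v j) • Pi.single i 1) = v
  rw [map_sub, map_smul, h1]
  change v - (∑ j, R.C x i j * v j) • Pi.single i 1 - _ = v
  rw [smul_neg]; abel

theorem cartanRefl_ρ (x : X) (i : Fin θ) :
    cartanRefl (R.C (R.ρ i x)) i = cartanRefl (R.C x) i := by
  funext v; simp only [cartanRefl, R.C_compat]

theorem wordEnd_append (x : X) (l l' : List (Fin θ)) :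
    R.wordEnd x (l ++ l') = R.wordEnd (R.wordEnd x l) l' := by
  induction l generalizing x with
  | nil => rfl
  | cons i l ih => exact ih _

theorem wordMap_append (x : X) (l l' : List (Fin θ)) (v : Fin θ → ℤ) :
    R.wordMap x (l ++ l') v = R.wordMap x l (R.wordMap (R.wordEnd x l) l' v) := by
  induction l generalizing x with
  | nil => rfl
  | cons i l ih => exact congrArg _ (ih _)

theorem wordEnd_injective (l : List (Fin θ)) : Injective fun x => R.wordEnd x l := by
  induction l with
  | nil => exact fun _ _ h => h
  | cons i l ih => exact fun _ _ h => (R.ρ i).injective (ih h)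

theorem wordEnd_reverse (x : X) (l : List (Fin θ)) :
    R.wordEnd (R.wordEnd x l) l.reverse = x := by
  induction l generalizing x with
  | nil => rfl
  | cons i l ih =>
    rw [List.reverse_cons, wordEnd_append]
    change R.ρ i (R.wordEnd (R.wordEnd (R.ρ i x) l) l.reverse) = x
    rw [ih, ρ_ρ]

theorem wordMap_reverse (x : X) (l : List (Fin θ)) (v : Fin θ → ℤ) :
    R.wordMap x l (R.wordMap (R.wordEnd x l) l.reverse v) = v := by
  induction l generalizing x v with
  | nil => rfl
  | cons i l ih =>
    rw [List.reverse_cons, wordMap_append, wordEnd, wordEnd_reverse]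
    change cartanRefl (R.C x) i (R.wordMap (R.ρ i x) l
      (R.wordMap (R.wordEnd (R.ρ i x) l) l.reverse (cartanRefl (R.C (R.ρ i x)) i v))) = v
    rw [ih, cartanRefl_ρ, cartanRefl_cartanRefl]

theorem wordMap_injective (x : X) (l : List (Fin θ)) : Injective (R.wordMap x l) := by
  induction l generalizing x with
  | nil => exact injective_id
  | cons i l ih =>
    exact (Function.LeftInverse.injective (R.cartanRefl_cartanRefl x i)).comp (ih _)

theorem wordMap_mem (x : X) (l : List (Fin θ)) {v : Fin θ → ℤ} (h : v ∈ R.Δ (R.wordEnd x l)) :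
    R.wordMap x l v ∈ R.Δ x := by
  induction l generalizing x with
  | nil => exact h
  | cons i l ih =>
    have h1 : cartanRefl (R.C (R.ρ i x)) i (R.wordMap (R.ρ i x) l v) ∈ R.Δ (R.ρ i (R.ρ i x)) := by
      rw [← R.root_refl]; exact ⟨_, ih _ h, rfl⟩
    rw [cartanRefl_ρ, ρ_ρ] at h1
    exact h1

theorem mem_of_wordMap_mem (x : X) (l : List (Fin θ)) {v : Fin θ → ℤ}
    (h : R.wordMap x l v ∈ R.Δ x) : v ∈ R.Δ (R.wordEnd x l) := by
  obtain ⟨w, rfl⟩ : ∃ w, R.wordMap (R.wordEnd x l) l.reverse w = v :=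
    ⟨R.wordMap x l v, R.wordMap_injective x l (R.wordMap_reverse x l _)⟩
  rw [wordMap_reverse] at h
  refine R.wordMap_mem _ _ ?_
  rwa [wordEnd_reverse]

theorem single_mem (x : X) (i : Fin θ) : (Pi.single i 1 : Fin θ → ℤ) ∈ R.Δ x := by
  have h : (Pi.single i 1 : Fin θ → ℤ) ∈
      R.Δ x ∩ {v | ∃ n : ℤ, v = n • (Pi.single i 1 : Fin θ → ℤ)} := by
    rw [R.root_simple]; exact Or.inl rfl
  exact h.1

theorem ne_zero_of_mem {x : X} {v : Fin θ → ℤ} (i : Fin θ) (h : v ∈ R.Δ x) : v ≠ 0 := by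
  rintro rfl
  have h1 : (0 : Fin θ → ℤ) ∈ R.Δ x ∩ {v | ∃ n : ℤ, v = n • (Pi.single i 1 : Fin θ → ℤ)} :=
    ⟨h, 0, by simp⟩
  rw [R.root_simple] at h1
  rcases h1 with h1 | h1 <;> simpa using congrFun h1 i

theorem nonneg_or_nonpos {x : X} {v : Fin θ → ℤ} (h : v ∈ R.Δ x) : 0 ≤ v ∨ v ≤ 0 := by
  rw [R.root_pos_neg] at h
  rcases h with h | ⟨w, h, rfl⟩
  · exact Or.inl h.2
  · exact Or.inr fun k => neg_nonpos.2 (h.2 k)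

theorem neg_mem {x : X} {v : Fin θ → ℤ} (h : v ∈ R.Δ x) : -v ∈ R.Δ x := by
  rw [R.root_pos_neg] at h
  rcases h with h | ⟨w, h, rfl⟩
  · rw [R.root_pos_neg]; exact Or.inr ⟨v, h, rfl⟩
  · simpa using h.1

/-- A simple reflection preserves negativity of all negative roots but one. -/
theorem cartanRefl_nonpos {x : X} {i : Fin θ} {v : Fin θ → ℤ} (h : v ∈ R.Δ x) (hv : v ≤ 0)
    (hne : v ≠ -Pi.single i 1) : cartanRefl (R.C x) i v ≤ 0 := by
  have hs : cartanRefl (R.C x) i v ∈ R.Δ (R.ρ i x) := by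
    rw [← R.root_refl]; exact ⟨v, h, rfl⟩
  rcases R.nonneg_or_nonpos hs with h1 | h1
  · exfalso
    have h2 : ∀ c, c ≠ i → v c = 0 := fun c hc =>
      le_antisymm (hv c) (by rw [← cartanRefl_apply_ne (R.C x) hc v]; exact h1 c)
    have h3 : v ∈ R.Δ x ∩ {v | ∃ n : ℤ, v = n • (Pi.single i 1 : Fin θ → ℤ)} := by
      refine ⟨h, v i, ?_⟩
      ext c
      by_cases hc : c = i
      · subst hc; simp
      · simp [hc, h2 c hc]
    rw [R.root_simple] at h3
    rcases h3 with h3 | h3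
    · have := hv i
      rw [h3] at this
      simp at this
    · exact hne h3
  · exact h1

/-- Two words based at `x` represent the same element of the Weyl groupoid. -/
def WordEquiv (x : X) (l l' : List (Fin θ)) : Prop :=
  R.wordEnd x l = R.wordEnd x l' ∧ R.wordMap x l = R.wordMap x l'

variable {R}

theorem WordEquiv.refl (x : X) (l : List (Fin θ)) : R.WordEquiv x l l := ⟨rfl, rfl⟩

theorem WordEquiv.symm {x : X} {l l' : List (Fin θ)} (h : R.WordEquiv x l l') :
    R.WordEquiv x l' l := ⟨h.1.symm, h.2.symm⟩

theorem WordEquiv.trans {x : X} {l l' l'' : List (Fin θ)} (h : R.WordEquiv x l l')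
    (h' : R.WordEquiv x l' l'') : R.WordEquiv x l l'' := ⟨h.1.trans h'.1, h.2.trans h'.2⟩

theorem WordEquiv.append_right {x : X} {l l' : List (Fin θ)} (h : R.WordEquiv x l l')
    (m : List (Fin θ)) : R.WordEquiv x (l ++ m) (l' ++ m) := by
  refine ⟨by rw [wordEnd_append, wordEnd_append, h.1], funext fun v => ?_⟩
  rw [wordMap_append, wordMap_append, h.1, h.2]

theorem WordEquiv.append_left {x : X} {l m m' : List (Fin θ)}
    (h : R.WordEquiv (R.wordEnd x l) m m') : R.WordEquiv x (l ++ m) (l ++ m') := by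
  refine ⟨by rw [wordEnd_append, wordEnd_append, h.1], funext fun v => ?_⟩
  rw [wordMap_append, wordMap_append, h.2]

variable (R)

theorem wordEquiv_cancel (x : X) (l m : List (Fin θ)) (i : Fin θ) :
    R.WordEquiv x (l ++ i :: i :: m) (l ++ m) := by
  refine WordEquiv.append_left ⟨?_, funext fun v => ?_⟩
  · simp only [wordEnd, ρ_ρ]
  · simp only [wordMap, comp_apply, cartanRefl_ρ, ρ_ρ, cartanRefl_cartanRefl]

/-- The positive roots at `x` lying in the span of `α_p` and `α_q`. -/
def pos₂ (x : X) (p q : Fin θ) : Set (Fin θ → ℤ) :=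
  {v ∈ R.Δ x | 0 ≤ v ∧ ∀ c, c ≠ p → c ≠ q → v c = 0}

/-- The root `s_p s_q ⋯ α_n` attached to an alternating word of length `k`. -/
def altRoot (x : X) (p q : Fin θ) (k : ℕ) : Fin θ → ℤ :=
  R.wordMap x (alt p q k) (Pi.single (nxt p q k) 1)

/-- The positive roots in `pos₂ x p q` which are images of negative roots under an
alternating word of length `k`. -/
def inv₂ (x : X) (p q : Fin θ) (k : ℕ) : Set (Fin θ → ℤ) :=
  {v ∈ R.pos₂ x p q | ∃ u ≤ 0, R.wordMap x (alt p q k) u = v}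

theorem pos₂_comm (x : X) (p q : Fin θ) : R.pos₂ x p q = R.pos₂ x q p := by
  ext v; exact ⟨fun h => ⟨h.1, h.2.1, fun c a b => h.2.2 c b a⟩,
    fun h => ⟨h.1, h.2.1, fun c a b => h.2.2 c b a⟩⟩

theorem eq_combination {p q : Fin θ} (hpq : p ≠ q) {v : Fin θ → ℤ}
    (h : ∀ c, c ≠ p → c ≠ q → v c = 0) :
    v = v p • (Pi.single p 1 : Fin θ → ℤ) + v q • (Pi.single q 1 : Fin θ → ℤ) := by
  ext c
  by_cases hp : c = p
  · subst hp; simp [hpq]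
  by_cases hq : c = q
  · subst hq; simp [hp]
  · simp [hp, hq, h c hp hq]

theorem pos₂_eq (x : X) {p q : Fin θ} (hpq : p ≠ q) :
    R.pos₂ x p q = R.Δ x ∩ {v | ∃ a b : ℕ,
      v = a • (Pi.single p 1 : Fin θ → ℤ) + b • Pi.single q 1} := by
  ext v
  constructor
  · rintro ⟨h, h0, hs⟩
    refine ⟨h, (v p).toNat, (v q).toNat, ?_⟩
    have hp : ((v p).toNat : ℤ) = v p := Int.toNat_of_nonneg (h0 p)
    have hq : ((v q).toNat : ℤ) = v q := Int.toNat_of_nonneg (h0 q)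
    rw [← natCast_zsmul, ← natCast_zsmul, hp, hq]
    exact eq_combination hpq hs
  · rintro ⟨h, a, b, rfl⟩
    refine ⟨h, ?_, fun c hp hq => by simp [hp, hq]⟩
    have : ∀ i : Fin θ, (0 : Fin θ → ℤ) ≤ Pi.single i 1 := fun i => by simp
    exact add_nonneg (nsmul_nonneg (this p) a) (nsmul_nonneg (this q) b)

theorem wordMap_alt_apply (x : X) (p q : Fin θ) (k : ℕ) (v : Fin θ → ℤ) {c : Fin θ}
    (hp : c ≠ p) (hq : c ≠ q) : R.wordMap x (alt p q k) v c = v c := by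
  induction k generalizing x p q with
  | zero => rfl
  | succ k ih =>
    change cartanRefl (R.C x) p (R.wordMap (R.ρ p x) (alt q p k) v) c = v c
    rw [cartanRefl_apply_ne _ hp, ih _ _ _ hq hp]

theorem altRoot_mem (x : X) (p q : Fin θ) (k : ℕ) : R.altRoot x p q k ∈ R.Δ x :=
  R.wordMap_mem _ _ (R.single_mem _ _)

theorem altRoot_apply (x : X) (p q : Fin θ) (k : ℕ) (c : Fin θ) (hp : c ≠ p) (hq : c ≠ q) :
    R.altRoot x p q k c = 0 := by
  rw [altRoot, wordMap_alt_apply _ _ _ _ _ _ hp hq]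
  rcases nxt_cases p q k with h | h <;> simp [h.1, hp, hq]

theorem wordMap_alt_succ (x : X) (p q : Fin θ) (k : ℕ) (v : Fin θ → ℤ) :
    R.wordMap x (alt p q (k + 1)) v = R.wordMap x (alt p q k)
      (cartanRefl (R.C (R.wordEnd x (alt p q k))) (nxt p q k) v) := by
  rw [alt_succ', wordMap_append]; rfl

theorem wordMap_alt_succ_single (x : X) (p q : Fin θ) (k : ℕ) :
    R.wordMap x (alt p q (k + 1)) (Pi.single (nxt p q k) 1) = -R.altRoot x p q k := by
  rw [wordMap_alt_succ, cartanRefl_single, altRoot, ← coe_wordLin, map_neg]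

theorem inv₂_succ (x : X) (p q : Fin θ) (k : ℕ) (h : 0 ≤ R.altRoot x p q k) :
    R.inv₂ x p q (k + 1) = insert (R.altRoot x p q k) (R.inv₂ x p q k) := by
  ext v
  constructor
  · rintro ⟨hv, u, hu, rfl⟩
    have hΔ : u ∈ R.Δ (R.wordEnd x (alt p q (k + 1))) := R.mem_of_wordMap_mem _ _ hv.1
    by_cases hne : u = -Pi.single (nxt p q k) 1
    · left
      rw [hne, ← coe_wordLin, map_neg, coe_wordLin, wordMap_alt_succ_single, neg_neg]
    · right
      refine ⟨hv, _, ?_, (R.wordMap_alt_succ x p q k u).symm⟩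
      have := R.cartanRefl_nonpos hΔ hu hne
      rwa [alt_succ', wordEnd_append, wordEnd, wordEnd, cartanRefl_ρ] at this
  · rintro (rfl | ⟨hv, u, hu, rfl⟩)
    · refine ⟨⟨R.altRoot_mem x p q k, h, R.altRoot_apply x p q k⟩,
        -Pi.single (nxt p q k) 1, by simp, ?_⟩
      rw [← coe_wordLin, map_neg, coe_wordLin, wordMap_alt_succ_single, neg_neg]
    · have hΔ : u ∈ R.Δ (R.wordEnd x (alt p q k)) := R.mem_of_wordMap_mem _ _ hv.1
      refine ⟨hv, cartanRefl (R.C (R.wordEnd x (alt p q k))) (nxt p q k) u, ?_, ?_⟩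
      · refine R.cartanRefl_nonpos hΔ hu ?_
        rintro rfl
        have h1 := hv.2.1
        rw [← coe_wordLin, map_neg, coe_wordLin] at h1
        exact R.ne_zero_of_mem p (R.altRoot_mem x p q k) (le_antisymm (neg_nonneg.1 h1) h)
      · rw [wordMap_alt_succ, cartanRefl_cartanRefl]

theorem altRoot_notMem_inv₂ (x : X) (p q : Fin θ) (k : ℕ) :
    R.altRoot x p q k ∉ R.inv₂ x p q k := by
  rintro ⟨-, u, hu, h⟩
  rw [R.wordMap_injective _ _ h] at hu
  simpa using hu (nxt p q k)

theorem inv₂_zero (x : X) (p q : Fin θ) : R.inv₂ x p q 0 = ∅ := by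
  refine Set.eq_empty_iff_forall_notMem.2 ?_
  rintro v ⟨hv, u, hu, rfl⟩
  exact R.ne_zero_of_mem p hv.1 (le_antisymm hu hv.2.1)

theorem inv₂_finite_ncard (x : X) (p q : Fin θ) (m : ℕ)
    (h : ∀ k < m, 0 ≤ R.altRoot x p q k) :
    (R.inv₂ x p q m).Finite ∧ (R.inv₂ x p q m).ncard = m := by
  induction m with
  | zero => simp [inv₂_zero]
  | succ m ih =>
    obtain ⟨h1, h2⟩ := ih fun k hk => h k (by omega)
    rw [R.inv₂_succ x p q m (h m (by omega))]
    exact ⟨h1.insert _, by rw [Set.ncard_insert_of_notMem (R.altRoot_notMem_inv₂ x p q m) h1, h2]⟩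

theorem exists_altRoot_not_nonneg {x : X} {p q : Fin θ} (h : (R.pos₂ x p q).Finite) :
    ∃ k, ¬ 0 ≤ R.altRoot x p q k := by
  by_contra! hk
  have h1 := (R.inv₂_finite_ncard x p q ((R.pos₂ x p q).ncard + 1) fun k _ => hk k).2
  have h2 := Set.ncard_le_ncard
    (show R.inv₂ x p q ((R.pos₂ x p q).ncard + 1) ⊆ _ from fun v hv => hv.1) h
  omega

/-- `m + 1` is the number of roots before the first negative one in the sequence of roots
given by the alternating word. -/
def FirstNeg (x : X) (p q : Fin θ) (m : ℕ) : Prop :=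
  (∀ k ≤ m, 0 ≤ R.altRoot x p q k) ∧ R.altRoot x p q (m + 1) ≤ 0

theorem exists_firstNeg {x : X} {p q : Fin θ} {k : ℕ} (h : ¬ 0 ≤ R.altRoot x p q k) :
    ∃ m, m + 1 ≤ k ∧ R.FirstNeg x p q m := by
  classical
  have hex : ∃ k, ¬ 0 ≤ R.altRoot x p q k := ⟨k, h⟩
  obtain ⟨m, hm⟩ : ∃ m, Nat.find hex = m + 1 := by
    refine Nat.exists_eq_succ_of_ne_zero fun h0 => ?_
    refine Nat.find_spec hex ?_
    rw [h0]
    change (0 : Fin θ → ℤ) ≤ Pi.single p 1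
    simp
  refine ⟨m, hm ▸ Nat.find_min' hex h, fun j hj => ?_, ?_⟩
  · exact not_not.1 (Nat.find_min hex (by omega))
  · have := Nat.find_spec hex
    rw [hm] at this
    exact (R.nonneg_or_nonpos (R.altRoot_mem x p q (m + 1))).resolve_left this

variable {R}

theorem FirstNeg.inv₂_eq {x : X} {p q : Fin θ} {m : ℕ} (hpq : p ≠ q) (h : R.FirstNeg x p q m) :
    R.inv₂ x p q (m + 1) = R.pos₂ x p q := by
  refine Set.Subset.antisymm (fun v hv => hv.1) fun v hv => ⟨hv, ?_⟩
  set w := R.wordMap (R.wordEnd x (alt p q (m + 1))) (alt p q (m + 1)).reverse v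
  have hwv : R.wordMap x (alt p q (m + 1)) w = v := R.wordMap_reverse _ _ _
  have hwΔ : w ∈ R.Δ (R.wordEnd x (alt p q (m + 1))) :=
    R.mem_of_wordMap_mem _ _ (hwv ▸ hv.1)
  rcases R.nonneg_or_nonpos hwΔ with h0 | h0
  · exfalso
    have hs : ∀ c, c ≠ p → c ≠ q → w c = 0 := fun c a b => by
      rw [← R.wordMap_alt_apply x p q (m + 1) w a b, hwv, hv.2.2 c a b]
    have hcomb : w = w (nxt p q m) • (Pi.single (nxt p q m) 1 : Fin θ → ℤ)
        + w (nxt q p m) • (Pi.single (nxt q p m) 1 : Fin θ → ℤ) := by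
      rcases nxt_cases p q m with e | e
      · rw [e.1, e.2]; exact eq_combination hpq hs
      · rw [e.1, e.2]; exact eq_combination hpq.symm fun c a b => hs c b a
    have hv0 : v ≤ 0 := by
      rw [← hwv, hcomb, ← coe_wordLin, map_add, map_smul, map_smul, coe_wordLin,
        wordMap_alt_succ_single]
      refine add_nonpos ?_ ?_
      · rw [smul_neg]; exact neg_nonpos.2 (smul_nonneg (h0 _) (h.1 m le_rfl))
      · exact smul_nonpos_of_nonneg_of_nonpos (h0 _) h.2
    exact R.ne_zero_of_mem p hv.1 (le_antisymm hv0 hv.2.1)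
  · exact ⟨w, h0, hwv⟩

theorem FirstNeg.finite_ncard {x : X} {p q : Fin θ} {m : ℕ} (hpq : p ≠ q)
    (h : R.FirstNeg x p q m) : (R.pos₂ x p q).Finite ∧ (R.pos₂ x p q).ncard = m + 1 := by
  rw [← h.inv₂_eq hpq]
  exact R.inv₂_finite_ncard x p q (m + 1) fun k hk => h.1 k (by omega)

theorem FirstNeg.symm {x : X} {p q : Fin θ} {m : ℕ} (hpq : p ≠ q)
    (h : R.FirstNeg x p q m) : R.FirstNeg x q p m := by
  have h1 := h.finite_ncard hpq
  rw [pos₂_comm] at h1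
  obtain ⟨k, hk⟩ := R.exists_altRoot_not_nonneg h1.1
  obtain ⟨m', -, hm'⟩ := R.exists_firstNeg hk
  have h2 := (hm'.finite_ncard hpq.symm).2
  obtain rfl : m' = m := by omega
  exact hm'

variable (R)

theorem single_mem_pos₂ (x : X) (p q : Fin θ) : Pi.single p 1 ∈ R.pos₂ x p q :=
  ⟨R.single_mem x p, by simp, fun c hc _ => by simp [hc]⟩

/-- If the negative of a word maps `α_c` into `pos₂ x p q`, and both `α_p` and `α_q` are images
of negative vectors, then `α_c` is mapped to `-α_p` or `-α_q`. -/
theorem neg_wordMap_single {x : X} {l : List (Fin θ)} {p q c : Fin θ} (hpq : p ≠ q)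
    (hp : ∃ u ≤ 0, R.wordMap x l u = Pi.single p 1)
    (hq : ∃ u ≤ 0, R.wordMap x l u = Pi.single q 1)
    {v : Fin θ → ℤ} (hv : v ∈ R.pos₂ x p q) (hc : R.wordMap x l (Pi.single c 1) = -v) :
    v = Pi.single p 1 ∨ v = Pi.single q 1 := by
  obtain ⟨u, hu, hup⟩ := hp
  obtain ⟨w, hw, hwq⟩ := hq
  have hcomb := eq_combination hpq hv.2.2
  have h1 : (Pi.single c 1 : Fin θ → ℤ) = -(v p • u + v q • w) := by
    apply R.wordMap_injective x l
    rw [hc, ← coe_wordLin, map_neg, map_add, map_smul, map_smul, coe_wordLin, hup, hwq, ← hcomb]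
  have hsum : ∀ u : Fin θ → ℤ, u ≤ 0 → u ≠ 0 → ∑ k, u k ≤ -1 := by
    intro u hu hne
    have := Finset.sum_nonpos (s := Finset.univ) fun k _ => hu k
    change ∑ k, u k ≤ 0 at this
    rcases this.lt_or_eq with h | h
    · omega
    · exfalso
      rw [Finset.sum_eq_zero_iff_of_nonpos fun k _ => hu k] at h
      exact hne (funext fun k => h k (Finset.mem_univ k))
  have hne : ∀ (u : Fin θ → ℤ) (i : Fin θ), R.wordMap x l u = Pi.single i 1 → u ≠ 0 := by
    rintro u i h rfl
    rw [← coe_wordLin, map_zero] at h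
    simpa using congrFun h i
  have hsu := hsum u hu (hne u p hup)
  have hsw := hsum w hw (hne w q hwq)
  have h2 : (1 : ℤ) = -(v p * ∑ k, u k + v q * ∑ k, w k) := by
    have := congrArg (fun f : Fin θ → ℤ => ∑ k, f k) h1
    simpa [Finset.sum_add_distrib, Finset.mul_sum, Pi.single_apply] using this
  have hvp : 0 ≤ v p := hv.2.1 p
  have hvq : 0 ≤ v q := hv.2.1 q
  have h3 : v p + v q ≤ 1 := by nlinarith
  have h4 : v p = 0 ∧ v q = 1 ∨ v p = 1 ∧ v q = 0 := by
    have : ¬ (v p = 0 ∧ v q = 0) := by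
      rintro ⟨a, b⟩; rw [a, b] at h2; simp at h2
    omega
  rcases h4 with ⟨a, b⟩ | ⟨a, b⟩ <;> rw [a, b] at hcomb
  · right; simpa using hcomb
  · left; simpa using hcomb

variable {R}

theorem FirstNeg.wordMap_single {x : X} {p q : Fin θ} {m : ℕ} (hpq : p ≠ q)
    (h : R.FirstNeg x p q m) :
    R.wordMap x (alt p q (m + 1)) (Pi.single (nxt p q m) 1) = -Pi.single q 1 ∧
      R.wordMap x (alt p q (m + 1)) (Pi.single (nxt q p m) 1) = -Pi.single p 1 := by
  have hinv := h.inv₂_eq hpq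
  have hp : ∃ u ≤ 0, R.wordMap x (alt p q (m + 1)) u = Pi.single p 1 := by
    have := R.single_mem_pos₂ x p q
    rw [← hinv] at this
    exact this.2
  have hq : ∃ u ≤ 0, R.wordMap x (alt p q (m + 1)) u = Pi.single q 1 := by
    have := R.single_mem_pos₂ x q p
    rw [pos₂_comm, ← hinv] at this
    exact this.2
  have hm0 : m ≠ 0 := by
    rintro rfl
    have h1 : R.altRoot x p q 1 q = 1 := by
      change cartanRefl (R.C x) p (Pi.single q 1) q = 1
      rw [cartanRefl_apply_ne _ hpq.symm]; simp
    have h2 : R.altRoot x p q 1 q ≤ 0 := h.2 q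
    omega
  have hpmem : ∀ k, k + 1 ≤ m → Pi.single p 1 ∈ R.inv₂ x p q (k + 1) := by
    intro k
    induction k with
    | zero => intro _; rw [R.inv₂_succ x p q 0 (h.1 0 (by omega))]; exact Or.inl rfl
    | succ k ih =>
      intro hk
      rw [R.inv₂_succ x p q (k + 1) (h.1 _ (by omega))]
      exact Or.inr (ih (by omega))
  have hne : R.altRoot x p q m ≠ Pi.single p 1 := by
    intro he
    obtain ⟨k, rfl⟩ := Nat.exists_eq_succ_of_ne_zero hm0
    exact R.altRoot_notMem_inv₂ x p q (k + 1) (he ▸ hpmem k le_rfl)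
  have h1 := R.wordMap_alt_succ_single x p q m
  have h1' : R.altRoot x p q m = Pi.single q 1 :=
    (R.neg_wordMap_single hpq hp hq
      ⟨R.altRoot_mem x p q m, h.1 m le_rfl, R.altRoot_apply x p q m⟩ h1).resolve_left hne
  have h2 : R.wordMap x (alt p q (m + 1)) (Pi.single (nxt q p m) 1)
      = -(-R.altRoot x p q (m + 1)) := by rw [neg_neg]; rfl
  have h2' := R.neg_wordMap_single hpq hp hq
      ⟨R.neg_mem (R.altRoot_mem x p q (m + 1)), neg_nonneg.2 h.2, fun c a b => by
        rw [Pi.neg_apply, R.altRoot_apply x p q _ c a b, neg_zero]⟩ h2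
  refine ⟨by rw [h1, h1'], ?_⟩
  rcases h2' with h2' | h2'
  · rw [h2, h2']
  · exfalso
    have h3 := R.wordMap_injective _ _ ((h1.trans (by rw [h1'])).trans (h2.trans (by rw [h2'])).symm)
    have h4 : nxt p q m ≠ nxt q p m := by
      rcases nxt_cases p q m with e | e <;> rw [e.1, e.2]
      exacts [hpq, hpq.symm]
    simpa [h4] using congrFun h3 (nxt p q m)

variable (R) in
theorem wordEnd_alt_two_mul (x : X) (p q : Fin θ) (m : ℕ) :
    R.wordEnd x (alt q p (2 * m)) = ((R.ρ p * R.ρ q) ^ m) x := by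
  induction m generalizing x with
  | zero => rfl
  | succ m ih => rw [pow_succ, Equiv.Perm.mul_apply, ← ih]; rfl

/-- The Coxeter relation of rank two. -/
theorem FirstNeg.wordEquiv {x : X} {p q : Fin θ} {m : ℕ} (hpq : p ≠ q)
    (h : R.FirstNeg x p q m) : R.WordEquiv x (alt p q (m + 1)) (alt q p (m + 1)) := by
  have h' := h.symm hpq
  have hend : R.wordEnd x (alt p q (m + 1)) = R.wordEnd x (alt q p (m + 1)) := by
    have hf := h.finite_ncard hpq
    rw [R.pos₂_eq x hpq] at hf
    have h1 := R.root_coxeter x p q hpq hf.1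
    rw [hf.2, ← wordEnd_alt_two_mul, alt_two_mul, wordEnd_append] at h1
    exact R.wordEnd_injective _ ((R.wordEnd_reverse x _).trans h1.symm)
  obtain ⟨h1, h2⟩ := h.wordMap_single hpq
  obtain ⟨h1', h2'⟩ := h'.wordMap_single hpq.symm
  refine ⟨hend, ?_⟩
  have hpq_eq : ∀ c, c = p ∨ c = q → R.wordMap x (alt p q (m + 1)) (Pi.single c 1)
      = R.wordMap x (alt q p (m + 1)) (Pi.single c 1) := by
    intro c hc
    have : c = nxt p q m ∨ c = nxt q p m := by
      rcases nxt_cases p q m with e | e <;> rw [e.1, e.2] <;> tauto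
    rcases this with rfl | rfl
    · rw [h1, h2']
    · rw [h2, h1']
  -- comparison of the two words on the remaining simple roots
  have key : ∀ a b : Fin θ, (a = p ∧ b = q ∨ a = q ∧ b = p) → ∀ c, c ≠ p → c ≠ q →
      ∃ d : Fin θ → ℤ, 0 ≤ d ∧ (∀ e, e ≠ p → e ≠ q → d e = 0) ∧
        R.wordMap x (alt a b (m + 1)) (Pi.single c 1 + d)
          = R.wordMap x (alt b a (m + 1)) (Pi.single c 1) := by
    intro a b hab c hcp hcq
    have hend' : R.wordEnd x (alt a b (m + 1)) = R.wordEnd x (alt b a (m + 1)) := by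
      rcases hab with ⟨rfl, rfl⟩ | ⟨rfl, rfl⟩
      exacts [hend, hend.symm]
    set v := R.wordMap x (alt b a (m + 1)) (Pi.single c 1) with hv
    set w := R.wordMap (R.wordEnd x (alt a b (m + 1))) (alt a b (m + 1)).reverse v
    have hwv : R.wordMap x (alt a b (m + 1)) w = v := R.wordMap_reverse _ _ _
    have hwΔ : w ∈ R.Δ (R.wordEnd x (alt a b (m + 1))) :=
      R.mem_of_wordMap_mem _ _ (hwv ▸ R.wordMap_mem _ _ (R.single_mem _ _))
    have hwe : ∀ e, e ≠ p → e ≠ q → w e = (Pi.single c 1 : Fin θ → ℤ) e := by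
      intro e hep heq
      have hea : e ≠ a ∧ e ≠ b := by
        rcases hab with ⟨rfl, rfl⟩ | ⟨rfl, rfl⟩
        exacts [⟨hep, heq⟩, ⟨heq, hep⟩]
      rw [← R.wordMap_alt_apply x a b (m + 1) w hea.1 hea.2, hwv, hv,
        R.wordMap_alt_apply x b a (m + 1) _ hea.2 hea.1]
    have hw0 : 0 ≤ w := by
      refine (R.nonneg_or_nonpos hwΔ).resolve_right fun h0 => ?_
      have := h0 c
      rw [hwe c hcp hcq] at this
      simp at this
    refine ⟨w - Pi.single c 1, fun e => ?_, fun e a b => by simp [hwe e a b], ?_⟩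
    · by_cases hec : e = c
      · subst hec; simp [hwe e hcp hcq]
      · simpa [hec] using hw0 e
    · rw [add_sub_cancel, hwv]
  have hsingle : ∀ c, R.wordMap x (alt p q (m + 1)) (Pi.single c 1)
      = R.wordMap x (alt q p (m + 1)) (Pi.single c 1) := by
    intro c
    by_cases hc : c = p ∨ c = q
    · exact hpq_eq c hc
    push Not at hc
    obtain ⟨d, hd0, hds, hd⟩ := key p q (Or.inl ⟨rfl, rfl⟩) c hc.1 hc.2
    obtain ⟨d', hd0', hds', hd'⟩ := key q p (Or.inr ⟨rfl, rfl⟩) c hc.1 hc.2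
    have hagree : R.wordMap x (alt q p (m + 1)) d = R.wordMap x (alt p q (m + 1)) d := by
      rw [eq_combination hpq hds]
      simp only [← coe_wordLin, map_add, map_smul]
      simp only [coe_wordLin, hpq_eq p (Or.inl rfl), hpq_eq q (Or.inr rfl)]
    have hsum : R.wordMap x (alt q p (m + 1)) (Pi.single c 1 + (d' + d))
        = R.wordMap x (alt q p (m + 1)) (Pi.single c 1) := by
      rw [← hd, ← add_assoc, ← coe_wordLin, map_add, coe_wordLin, hd', hagree,
        ← coe_wordLin, ← map_add]
    have hzero : d' + d = 0 := by simpa using R.wordMap_injective _ _ hsum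
    have hd00 : d = 0 := le_antisymm (fun e => by
      have h1 := congrFun hzero e
      have h2 := hd0' e
      simp only [Pi.add_apply, Pi.zero_apply] at h1 h2 ⊢
      omega) hd0
    rw [← hd, hd00, add_zero]
  have hlin : R.wordLin x (alt p q (m + 1)) = R.wordLin x (alt q p (m + 1)) := by
    refine LinearMap.pi_ext' fun c => LinearMap.ext_ring ?_
    simp only [LinearMap.comp_apply, LinearMap.single_apply, coe_wordLin]
    exact hsingle c
  rw [← coe_wordLin, ← coe_wordLin, hlin]

variable (R)

/-- In rank two, either the root of an alternating word is positive, or appending the next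
letter shortens the word. -/
theorem altRoot_nonneg_or_shorter (x : X) {p q : Fin θ} (hpq : p ≠ q) (k : ℕ) :
    0 ≤ R.altRoot x p q k ∨
      ∃ l' : List (Fin θ), l'.length < k ∧ R.WordEquiv x (alt p q k ++ [nxt p q k]) l' := by
  by_cases h : 0 ≤ R.altRoot x p q k
  · exact Or.inl h
  right
  obtain ⟨m, hmk, hm⟩ := R.exists_firstNeg h
  obtain ⟨r, rfl⟩ := Nat.exists_eq_add_of_le hmk
  refine ⟨alt q p m ++ alt (nxt q p (m + 1)) (nxt p q (m + 1)) r, ?_, ?_⟩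
  · rw [List.length_append, alt_length, alt_length]; omega
  · rw [← alt_succ', add_assoc, alt_add]
    refine ((hm.wordEquiv hpq).append_right _).trans ?_
    rw [alt_succ' q p m, List.append_assoc]
    exact R.wordEquiv_cancel x (alt q p m) _ (nxt q p m)

/-- A word is reduced if no equivalent word is shorter. -/
def Reduced (x : X) (l : List (Fin θ)) : Prop :=
  ∀ l', R.WordEquiv x l l' → l.length ≤ l'.length

theorem wordMap_single_nonneg (x : X) (l : List (Fin θ)) (hl : R.Reduced x l) (j : Fin θ)
    (hj : ∀ l', R.WordEquiv x (l ++ [j]) l' → l.length ≤ l'.length) :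
    0 ≤ R.wordMap x l (Pi.single j 1) := by
  induction ht : l.length using Nat.strong_induction_on generalizing l j with
  | _ t ih =>
  subst ht
  rcases List.eq_nil_or_concat l with rfl | ⟨l₀, i, hli⟩
  · simp [wordMap]
  rw [List.concat_eq_append] at hli
  have hij : i ≠ j := by
    rintro rfl
    have := hj l₀ (by
      rw [hli, List.append_assoc]
      simpa using R.wordEquiv_cancel x l₀ [] i)
    rw [hli] at this
    simp at this
  let S : ℕ → Prop := fun k => ∃ (p q : Fin θ) (v : List (Fin θ)), p ≠ q ∧ nxt p q (k + 1) = j ∧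
    v.length + (k + 1) = l.length ∧ R.WordEquiv x l (v ++ alt p q (k + 1))
  have hS0 : S 0 := ⟨i, j, l₀, hij, rfl, by rw [hli]; simp, by rw [hli]; exact .refl _ _⟩
  obtain ⟨k, hk, hmax⟩ : ∃ k, S k ∧ ¬ S (k + 1) := by
    by_contra! hcon
    have hall : ∀ k, S k := fun k => by
      induction k with
      | zero => exact hS0
      | succ k ih => exact hcon k ih
    obtain ⟨_, _, v, _, _, hlen, _⟩ := hall l.length
    omega
  obtain ⟨p, q, v, hpq, hn, hlen, heq⟩ := hk
  have hvred : R.Reduced x v := by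
    intro v' hv'
    have := hl (v' ++ alt p q (k + 1)) (heq.trans (hv'.append_right _))
    rw [List.length_append, alt_length] at this
    omega
  have hvp : 0 ≤ R.wordMap x v (Pi.single p 1) := by
    refine ih v.length (by omega) v hvred p (fun v' hv' => ?_) rfl
    have := hl (v' ++ alt q p k) (heq.trans (by
      have := hv'.append_right (alt q p k)
      rw [List.append_assoc] at this
      exact this))
    rw [List.length_append, alt_length] at this
    omega
  have hvq : 0 ≤ R.wordMap x v (Pi.single q 1) := by
    refine ih v.length (by omega) v hvred q (fun v' hv' => ?_) rfl
    by_contra! hlt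
    have he : R.WordEquiv x l (v' ++ alt q p (k + 1 + 1)) := by
      refine heq.trans ?_
      refine .trans ?_ (hv'.append_right _)
      rw [List.append_assoc]
      exact (R.wordEquiv_cancel x v _ q).symm
    have h1 := hl _ he
    rw [List.length_append, alt_length] at h1
    exact hmax ⟨q, p, v', hpq.symm, hn, by omega, he⟩
  rw [heq.2, wordMap_append]
  rcases R.altRoot_nonneg_or_shorter (R.wordEnd x v) hpq (k + 1) with h | ⟨l', hl', he⟩
  · rw [altRoot, hn] at h
    rw [eq_combination hpq (v := R.wordMap (R.wordEnd x v) (alt p q (k + 1)) (Pi.single j 1))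
      (fun c a b => by
        have := R.altRoot_apply (R.wordEnd x v) p q (k + 1) c a b
        rwa [altRoot, hn] at this), ← coe_wordLin, map_add, map_smul, map_smul, coe_wordLin]
    exact add_nonneg (smul_nonneg (h p) hvp) (smul_nonneg (h q) hvq)
  · exfalso
    have := hj (v ++ l') ((heq.append_right [j]).trans (by
      rw [List.append_assoc]
      rw [hn] at he
      exact he.append_left))
    rw [List.length_append] at this
    omega

theorem exists_length_eq_len (x : X) (l : List (Fin θ)) :
    ∃ l', l'.length = R.len x (R.wordMap x l) (R.wordEnd x l) ∧ R.WordEquiv x l l' := by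
  have hne : {t | ∃ l' : List (Fin θ), l'.length = t ∧ R.wordEnd x l' = R.wordEnd x l ∧
      R.wordMap x l' = R.wordMap x l}.Nonempty := ⟨_, l, rfl, rfl, rfl⟩
  obtain ⟨l', h1, h2, h3⟩ := Nat.sInf_mem hne
  exact ⟨l', h1, h2.symm, h3.symm⟩

variable {R} in
theorem WordEquiv.len_le {x : X} {l l' : List (Fin θ)} (h : R.WordEquiv x l l') :
    R.len x (R.wordMap x l) (R.wordEnd x l) ≤ l'.length :=
  Nat.sInf_le ⟨l', rfl, h.1.symm, h.2.symm⟩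

theorem len_append_eq_iff (x : X) (l : List (Fin θ))
    (hred : R.len x (R.wordMap x l) (R.wordEnd x l) = l.length) (j : Fin θ) :
    R.len x (R.wordMap x (l ++ [j])) (R.wordEnd x (l ++ [j])) = l.length + 1 ↔
      0 ≤ R.wordMap x l (Pi.single j 1) := by
  have hl : R.Reduced x l := fun l' h => hred ▸ h.len_le
  obtain ⟨l', hlen, he⟩ := R.exists_length_eq_len x (l ++ [j])
  constructor
  · intro h
    exact R.wordMap_single_nonneg x l hl j fun l'' h'' => by have := h''.len_le; omega
  · intro h
    have hle := (WordEquiv.refl (R := R) x (l ++ [j])).len_le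
    rw [List.length_append, List.length_singleton] at hle
    have hback : R.WordEquiv x (l' ++ [j]) l := by
      refine (he.symm.append_right [j]).trans ?_
      rw [List.append_assoc]
      simpa using R.wordEquiv_cancel x l [] j
    by_contra hne
    have hl' : R.Reduced x l' := fun l'' h'' => by
      have := (he.trans h'').len_le; omega
    have h1 := R.wordMap_single_nonneg x l' hl' j fun l'' h'' => by
      have := hl l'' (hback.symm.trans h''); omega
    rw [← he.2, wordMap_append] at h1
    change 0 ≤ R.wordMap x l (cartanRefl _ j (Pi.single j 1)) at h1
    rw [cartanRefl_single, ← coe_wordLin, map_neg, coe_wordLin] at h1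
    exact R.ne_zero_of_mem j (R.wordMap_mem x l (R.single_mem _ j))
      (le_antisymm (neg_nonneg.1 h1) h)

end GRS

/-- Let `w = ς_{i_1}^x ⋯ ς_{i_t}` be a reduced expression (given by the word `l`),
with `w = (x, g, y)`. Then for every `j`, `ℓ(w ς_j^y) = t + 1` if and only if
`g(α_j) ∈ Δ^x_+`, i.e. if and only if `g(α_j) ∈ ℕ₀^θ`. -/
theorem stmt5 {θ : ℕ} {X : Type*} (R : GRS θ X) (x : X) (l : List (Fin θ))
    (hred : R.len x (R.wordMap x l) (R.wordEnd x l) = l.length) (j : Fin θ) :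
    (R.len x (R.wordMap x (l ++ [j])) (R.wordEnd x (l ++ [j])) = l.length + 1 ↔
      R.wordMap x l (Pi.single j 1) ∈ R.pos x) ∧
    (R.len x (R.wordMap x (l ++ [j])) (R.wordEnd x (l ++ [j])) = l.length + 1 ↔
      ∀ k, 0 ≤ R.wordMap x l (Pi.single j 1) k) := by
  have hiff := R.len_append_eq_iff x l hred j
  exact ⟨hiff.trans ⟨fun h => ⟨R.wordMap_mem x l (R.single_mem _ j), h⟩, fun h => h.2⟩, hiff⟩
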